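/- Let n ≥ 2 and R > 0. There exists a constant C = C(n) > 0 such that for every φ ∈ C^∞((0,∞)×ℝⁿ) with supp φ(t,·) ⊂ {x ∈ ℝⁿ : |x| < t + R}, for all t > 0 and all x = rω with 0 < r < t + R, ω ∈ S^{n−1}: r^{(n−1)/2}(t − r + R)^{−1/2} |φ(t,x)| ≤ C Σ_{|a| ≤ [(n−1)/2]+1} ( ∫₀^{t+R} ∫_{S^{n−1}} |(∇_x Ω^a φ)(t,ρω)|² ρ^{n−1} dρ dS(ω) )^{1/2}, where Ω^a denotes any product of |a| of the rotation fields Ω_{ij} = x_i∂_j − x_j∂_i (1 ≤ i < j ≤ n) and [p] is the greatest integer not exceeding p. -/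

import Mathlib

open MeasureTheory Real Set

noncomputable section

/-- Partial derivative `∂_i` on ℝ^{1+n} (coordinate `0` is time). -/
def pdn {m : ℕ} (i : Fin m) (u : (Fin m → ℝ) → ℝ) : (Fin m → ℝ) → ℝ :=
  fun y => fderiv ℝ u y (Pi.single i 1)

/-- Euclidean length `|x|` of a space point in ℝⁿ. -/
def radn {n : ℕ} (x : Fin n → ℝ) : ℝ := Real.sqrt (∑ i, (x i) ^ 2)

/-- Index type for the `n`-dimensional Klainerman vector fields:
translations `∂_α`, rotations `Ω_{ij}`, boosts `L_k`, and the scaling field `S`. -/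
abbrev KIdx (n : ℕ) := Fin (n + 1) ⊕ (Fin n × Fin n) ⊕ Fin n ⊕ Unit

/-- The `n`-dimensional Klainerman vector fields (as coefficient vectors);
spatial coordinates are the indices `1, …, n`. -/
def KVFn {n : ℕ} : KIdx n → (Fin (n + 1) → ℝ) → Fin (n + 1) → ℝ
  | Sum.inl α, _ => Pi.single α 1
  | Sum.inr (Sum.inl (i, j)), y => Pi.single j.succ (y i.succ) - Pi.single i.succ (y j.succ)
  | Sum.inr (Sum.inr (Sum.inl k)), y => Pi.single 0 (y k.succ) + Pi.single k.succ (y 0)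
  | Sum.inr (Sum.inr (Sum.inr _)), y => y

/-- The Klainerman vector field `Z_i` applied to a function. -/
def Zopn {n : ℕ} (i : KIdx n) (u : (Fin (n + 1) → ℝ) → ℝ) : (Fin (n + 1) → ℝ) → ℝ :=
  fun y => fderiv ℝ u y (KVFn i y)

/-- Iterated Klainerman fields `Z^a`. -/
def Zitn {n : ℕ} : List (KIdx n) → ((Fin (n + 1) → ℝ) → ℝ) → (Fin (n + 1) → ℝ) → ℝ
  | [], u => u
  | i :: l, u => Zopn i (Zitn l u)

/-- All multi-indices `a` with `|a| ≤ m` (as lists of field indices). -/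
def kLists (n : ℕ) : ℕ → List (List (KIdx n))
  | 0 => [[]]
  | m + 1 => [] :: (kLists n m).flatMap fun l =>
      (Finset.univ : Finset (KIdx n)).toList.map fun i => i :: l


/-- The rotation field `Ω_{ij} = x_i ∂_j - x_j ∂_i` applied to a function on ℝ^{1+n}
(spatial coordinates are the indices `1, …, n`). -/
def rotOp {n : ℕ} (p : Fin n × Fin n) (u : (Fin (n + 1) → ℝ) → ℝ) :
    (Fin (n + 1) → ℝ) → ℝ :=
  fun y => fderiv ℝ u y (Pi.single p.2.succ (y p.1.succ) - Pi.single p.1.succ (y p.2.succ))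

/-- Iterated rotation fields `Ω^a`. -/
def rotIt {n : ℕ} : List (Fin n × Fin n) → ((Fin (n + 1) → ℝ) → ℝ) → (Fin (n + 1) → ℝ) → ℝ
  | [], u => u
  | p :: l, u => rotOp p (rotIt l u)

/-- All products of at most `m` rotation fields (as index lists). -/
def rotLists (n : ℕ) : ℕ → List (List (Fin n × Fin n))
  | 0 => [[]]
  | m + 1 => [] :: (rotLists n m).flatMap fun l =>
      (Finset.univ : Finset (Fin n × Fin n)).toList.map fun p => p :: l


theorem cs_int (a b : ℝ) (hab : a ≤ b) (f : ℝ → ℝ) (hf : Continuous f) :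
    (∫ s in a..b, f s) ^ 2 ≤ (b - a) * ∫ s in a..b, f s ^ 2 := by
  rcases hab.eq_or_lt with rfl | h
  · simp
  set I := ∫ s in a..b, f s with hI
  have h0 : 0 ≤ ∫ s in a..b, ((b-a) * f s - I)^2 :=
    intervalIntegral.integral_nonneg hab (fun u _ => sq_nonneg _)
  have e : (fun s => ((b-a) * f s - I)^2) = fun s => (b-a)^2 * f s ^2 - (2*(b-a)*I) * f s + I^2 := by
    funext s; ring
  rw [e, intervalIntegral.integral_add, intervalIntegral.integral_sub,
    intervalIntegral.integral_const_mul, intervalIntegral.integral_const_mul, ← hI] at h0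
  · simp only [intervalIntegral.integral_const, smul_eq_mul] at h0
    have hb : 0 < b - a := by linarith
    by_contra hc
    push Not at hc
    nlinarith
  all_goals apply Continuous.intervalIntegrable; fun_prop

theorem ibp (k : ℕ) (p : Polynomial ℝ) : ∃ a b : Polynomial ℝ, ∀ h h' : ℝ → ℝ,
    (∀ s, HasDerivAt h (h' s) s) → Continuous h' →
    ∫ s in (0:ℝ)..1, s ^ k * p.eval s * h s =
      (∫ s in (0:ℝ)..1, s ^ (k+1) * a.eval s * h s) +
      ∫ s in (0:ℝ)..1, s ^ (k+1) * b.eval s * h' s := by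
  obtain ⟨a, ha⟩ : ∃ a : Polynomial ℝ, a = Polynomial.C ((k+1:ℝ)⁻¹) * (Polynomial.C (k+2 : ℝ) * p - (1 - .X) * p.derivative) := ⟨_, rfl⟩
  obtain ⟨b, hb⟩ : ∃ b : Polynomial ℝ, b = Polynomial.C (-(k+1:ℝ)⁻¹) * ((1 - .X) * p) := ⟨_, rfl⟩
  refine ⟨a, b, fun h h' hd hc => ?_⟩
  have hch : Continuous h := continuous_iff_continuousAt.2 fun s => (hd s).continuousAt
  have hk : (k+1:ℝ) ≠ 0 := by positivity
  have key := intervalIntegral.integral_eq_sub_of_hasDerivAt (a := 0) (b := 1)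
    (f := fun s => s ^ (k+1) * ((1 - s) * p.eval s) * h s / (k+1))
    (f' := fun s => s ^ k * p.eval s * h s - s ^ (k+1) * a.eval s * h s - s ^ (k+1) * b.eval s * h' s)
    (fun s _ => by
      have := ((((hasDerivAt_id s).pow (k+1)).mul (((hasDerivAt_id s).const_sub 1).mul (p.hasDerivAt s))).mul (hd s)).div_const (k+1:ℝ)
      refine this.congr_deriv ?_
      simp [ha, hb]
      field_simp
      ring)
    (Continuous.intervalIntegrable (by fun_prop) _ _)
  rw [intervalIntegral.integral_sub, intervalIntegral.integral_sub] at key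
  · simp at key
    linarith
  all_goals apply Continuous.intervalIntegrable; fun_prop

theorem rep (k : ℕ) : ∃ q : ℕ → Polynomial ℝ, ∀ G : ℕ → ℝ → ℝ,
    (∀ j s, HasDerivAt (G j) (G (j+1) s) s) →
    G 0 0 = ∑ j ∈ Finset.range (k+2), ∫ s in (0:ℝ)..1, s ^ k * (q j).eval s * G j s := by
  induction k with
  | zero =>
    refine ⟨fun j => if j = 0 then 1 else .X - 1, fun G hG => ?_⟩
    have hc : ∀ j, Continuous (G j) := fun j => continuous_iff_continuousAt.2 fun s => (hG j s).continuousAt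
    have key := intervalIntegral.integral_eq_sub_of_hasDerivAt (a := 0) (b := 1)
      (f := fun s => (s - 1) * G 0 s) (f' := fun s => 1 * G 0 s + (s-1) * G 1 s)
      (fun s _ => ((hasDerivAt_id s).sub_const 1).mul (hG 0 s))
      (Continuous.intervalIntegrable (by have := hc 0; have := hc 1; fun_prop) _ _)
    rw [intervalIntegral.integral_add] at key
    · simp [Finset.sum_range_succ] at key ⊢
      exact key.symm
    all_goals apply Continuous.intervalIntegrable; have := hc 0; have := hc 1; fun_prop
  | succ k ih =>
    obtain ⟨q, hq⟩ := ih
    choose a b hab using fun j => ibp k (q j)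
    refine ⟨fun j => (if j < k+2 then a j else 0) + (if j = 0 then 0 else b (j-1)), fun G hG => ?_⟩
    have hc : ∀ j, Continuous (G j) := fun j => continuous_iff_continuousAt.2 fun s => (hG j s).continuousAt
    rw [hq G hG]
    have e : ∀ j, ∫ s in (0:ℝ)..1, s ^ (k+1) * ((if j < k+2 then a j else 0) + (if j = 0 then 0 else b (j-1))).eval s * G j s
      = (∫ s in (0:ℝ)..1, s ^ (k+1) * (if j < k+2 then a j else 0).eval s * G j s)
       + (∫ s in (0:ℝ)..1, s ^ (k+1) * (if j = 0 then 0 else b (j-1)).eval s * G j s) := by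
      intro j
      have := hc j
      rw [← intervalIntegral.integral_add]
      · apply intervalIntegral.integral_congr
        intro s _
        simp only [Polynomial.eval_add]; ring
      all_goals apply Continuous.intervalIntegrable; fun_prop
    simp_rw [e]
    rw [Finset.sum_add_distrib]
    conv_rhs => 
      congr
      · rw [Finset.sum_range_succ]
      · rw [Finset.sum_range_succ']
    simp only [hab _ _ _ (hG _) (hc _)]
    rw [Finset.sum_add_distrib]
    simp
    apply Finset.sum_congr rfl
    intro j hj
    have : j < k + 2 := Finset.mem_range.1 hj
    simp [this]

theorem repsq (k : ℕ) : ∃ C > (0:ℝ), ∀ G : ℕ → ℝ → ℝ,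
    (∀ j s, HasDerivAt (G j) (G (j+1) s) s) →
    (G 0 0)^2 ≤ C * ∑ j ∈ Finset.range (k+2), ∫ s in (0:ℝ)..1, s ^ (2*k) * (G j s)^2 := by
  obtain ⟨q, hq⟩ := rep k
  have hB : ∀ j, ∃ B > (0:ℝ), ∀ s ∈ Icc (0:ℝ) 1, ((q j).eval s)^2 ≤ B := by
    intro j
    obtain ⟨B, hB⟩ := (isCompact_Icc (a := (0:ℝ)) (b := 1)).exists_bound_of_continuousOn
      (f := fun s => ((q j).eval s)^2) (by fun_prop)
    exact ⟨|B| + 1, by positivity, fun s hs => (le_abs_self _).trans ((hB s hs).trans (by linarith [le_abs_self B]))⟩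
  choose B hB0 hB using hB
  refine ⟨(k+2) * ∑ j ∈ Finset.range (k+2), B j, ?_, fun G hG => ?_⟩
  · exact mul_pos (by positivity) (Finset.sum_pos (fun j _ => hB0 j) ⟨0, by simp⟩)
  have hc : ∀ j, Continuous (G j) := fun j => continuous_iff_continuousAt.2 fun s => (hG j s).continuousAt
  rw [hq G hG]
  refine sq_sum_le_card_mul_sum_sq.trans ?_
  rw [Finset.card_range, mul_assoc]
  push_cast
  refine mul_le_mul_of_nonneg_left ?_ (by positivity)
  rw [Finset.mul_sum]
  refine Finset.sum_le_sum fun j hj => ?_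
  have := hc j
  refine (cs_int 0 1 zero_le_one _ (by fun_prop)).trans ?_
  rw [sub_zero, one_mul, ← intervalIntegral.integral_const_mul]
  apply intervalIntegral.integral_mono_on zero_le_one
  · apply Continuous.intervalIntegrable; fun_prop
  · apply Continuous.intervalIntegrable; fun_prop
  intro s hs
  have h1 := hB j s hs
  have h2 : B j ≤ ∑ j ∈ Finset.range (k+2), B j := Finset.single_le_sum (fun i _ => (hB0 i).le) hj
  calc _ = (q j).eval s ^ 2 * (s^(2*k) * G j s ^2) := by ring
    _ ≤ _ := mul_le_mul_of_nonneg_right (h1.trans h2) (mul_nonneg (by rw [pow_mul]; positivity) (sq_nonneg _))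

theorem frame (d : ℕ) (ω : Fin (d+1) → ℝ) (hω : ∑ i, ω i ^ 2 = 1) :
    ∃ L : EuclideanSpace ℝ (Fin d) →ₗ[ℝ] (Fin (d+1) → ℝ),
      MeasurePreserving (fun p : ℝ × EuclideanSpace ℝ (Fin d) => p.1 • ω + L p.2) volume volume ∧
      (∀ w, ∑ i, ω i * L w i = 0) ∧ (∀ w, ∑ i, (L w i)^2 = ‖w‖^2) := by
  let W : EuclideanSpace ℝ (Fin (d+1)) := WithLp.toLp 2 ω
  have hW : ‖W‖ = 1 := by
    rw [EuclideanSpace.norm_eq]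
    simp [W, hω]
  obtain ⟨b, hb⟩ := Orthonormal.exists_orthonormalBasis_extension_of_card_eq (𝕜 := ℝ)
    (E := EuclideanSpace ℝ (Fin (d+1))) (ι := Fin (d+1)) (by simp) (v := fun _ => W) (s := {0}) (by
      constructor
      · intro i; simpa using hW
      · intro i j hij; exact absurd (Subsingleton.elim i j) hij)
  have hb0 : b 0 = W := hb 0 rfl
  let c : EuclideanSpace ℝ (Fin d) →ₗ[ℝ] EuclideanSpace ℝ (Fin (d+1)) :=
    { toFun := fun w => WithLp.toLp 2 (Fin.cons 0 (WithLp.ofLp w))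
      map_add' := fun x y => by ext i; refine Fin.cases ?_ (fun i => ?_) i <;> simp
      map_smul' := fun x y => by ext i; refine Fin.cases ?_ (fun i => ?_) i <;> simp }
  let L : EuclideanSpace ℝ (Fin d) →ₗ[ℝ] (Fin (d+1) → ℝ) :=
    (WithLp.linearEquiv 2 ℝ (Fin (d+1) → ℝ)).toLinearMap ∘ₗ b.repr.symm.toLinearEquiv.toLinearMap ∘ₗ c
  have hL : ∀ w, WithLp.toLp 2 (L w) = b.repr.symm (c w) := fun w => rfl
  refine ⟨L, ?_, ?_, ?_⟩
  · have h1 := (volume_preserving_piFinSuccAbove (fun _ : Fin (d+1) => ℝ) 0).symm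
    have h2 : MeasurePreserving (Prod.map id (WithLp.ofLp : EuclideanSpace ℝ (Fin d) → (Fin d → ℝ)) : ℝ × _ → ℝ × _) volume volume :=
      (MeasurePreserving.id volume).prod (PiLp.volume_preserving_ofLp (Fin d))
    have h3 := (PiLp.volume_preserving_ofLp (Fin (d+1))).comp (b.measurePreserving_repr_symm.comp ((PiLp.volume_preserving_toLp (Fin (d+1))).comp (h1.comp h2)))
    refine (congrArg (fun f => MeasurePreserving f volume volume) ?_).mpr h3
    funext p
    obtain ⟨h, w⟩ := p
    have : ∀ x : EuclideanSpace ℝ (Fin (d+1)), b.repr.symm x = ∑ i, x i • b i := fun x => by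
      rw [← b.sum_repr (b.repr.symm x)]; simp
    change h • ω + (b.repr.symm (c w)).ofLp = _
    simp only [Function.comp]
    rw [this, this, Fin.sum_univ_succ, Fin.sum_univ_succ]
    ext i
    simp [hb0, W, c, MeasurableEquiv.piFinSuccAbove]
  · intro w
    have : inner ℝ (b 0) (b.repr.symm (c w)) = 0 := by
      rw [← b.repr_apply_apply]; simp [c]
    rw [hb0, ← hL, PiLp.inner_apply] at this
    rw [← this]
    simp [W, mul_comm]
  · intro w
    have : ‖b.repr.symm (c w)‖^2 = ‖w‖^2 := by
      rw [LinearIsometryEquiv.norm_map, EuclideanSpace.norm_sq_eq, EuclideanSpace.norm_sq_eq, Fin.sum_univ_succ]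
      simp [c]
    rw [← this, ← hL, EuclideanSpace.norm_sq_eq]
    simp

open scoped ENNReal
abbrev EE (d : ℕ) := EuclideanSpace ℝ (Fin d)

theorem polar_w (d : ℕ) (hd : 1 ≤ d) (f : EE d → ℝ≥0∞) (hf : Measurable f) :
    ∫⁻ w, f w = ∫⁻ η : Metric.sphere (0 : EE d) 1, (∫⁻ q in Ioi (0:ℝ),
      ENNReal.ofReal (q ^ (d-1)) * f (q • (η : EE d))) ∂(volume : Measure (EE d)).toSphere := by
  have : Nontrivial (EE d) := by
    have : Nonempty (Fin d) := ⟨⟨0, hd⟩⟩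
    infer_instance
  have hm := (volume : Measure (EE d)).measurePreserving_homeomorphUnitSphereProd
  calc ∫⁻ w, f w = ∫⁻ w in ({0}ᶜ : Set (EE d)), f w := by
        rw [restrict_compl_singleton]
    _ = ∫⁻ w : ({0}ᶜ : Set (EE d)), f w ∂(Measure.comap Subtype.val volume) := by
        rw [lintegral_subtype_comap (by measurability)]
    _ = ∫⁻ p, f ((p.2 : ℝ) • (p.1 : EE d)) ∂((volume : Measure (EE d)).toSphere.prod (Measure.volumeIoiPow (Module.finrank ℝ (EE d) - 1))) := by
        rw [← hm.lintegral_comp]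
        · refine lintegral_congr fun w => ?_
          have h0 : ‖(w : EE d)‖ ≠ 0 := norm_ne_zero_iff.2 w.2
          simp [smul_smul, h0]
        · exact hf.comp (by fun_prop)
    _ = _ := by
        have hm1 : Measurable (fun p : Metric.sphere (0 : EE d) 1 × Ioi (0:ℝ) => f ((p.2 : ℝ) • (p.1 : EE d))) :=
          hf.comp (by fun_prop)
        rw [lintegral_prod _ hm1.aemeasurable]
        refine lintegral_congr fun η => ?_
        have hm2 : Measurable (fun q : Ioi (0:ℝ) => f ((q : ℝ) • (η : EE d))) := hf.comp (by fun_prop)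
        simp only [Measure.volumeIoiPow]
        rw [lintegral_withDensity_eq_lintegral_mul _ (by fun_prop) hm2]
        rw [← lintegral_subtype_comap measurableSet_Ioi]
        simp

theorem polar_le (d : ℕ) (hd : 1 ≤ d) (F : ℝ × EE d → ℝ≥0∞) (hF : Measurable F) (r T : ℝ) (hr : 0 < r) :
    ∫⁻ η : Metric.sphere (0 : EE d) 1, (∫⁻ s in Ioc (0:ℝ) 1, ∫⁻ ρ in Ioc r T,
      ENNReal.ofReal (ρ ^ d * sin s ^ (d-1)) * F (ρ * cos s, (ρ * sin s) • (η : EE d)))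
        ∂(volume : Measure (EE d)).toSphere ≤ ∫⁻ p, F p := by
  have hFm : ∀ h, Measurable fun w => F (h, w) := fun h => hF.comp (by fun_prop)
  calc _ ≤ ∫⁻ η : Metric.sphere (0 : EE d) 1, (∫⁻ p : ℝ × ℝ, (Ioi (0:ℝ)).indicator (fun q => ENNReal.ofReal (q ^ (d-1)) * F (p.1, q • (η : EE d))) p.2)
        ∂(volume : Measure (EE d)).toSphere := ?_
    _ = ∫⁻ η : Metric.sphere (0 : EE d) 1, (∫⁻ h : ℝ, ∫⁻ q in Ioi (0:ℝ), ENNReal.ofReal (q ^ (d-1)) * F (h, q • (η : EE d)))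
        ∂(volume : Measure (EE d)).toSphere := by
        refine lintegral_congr fun η => ?_
        rw [Measure.volume_eq_prod, lintegral_prod]
        · simp_rw [lintegral_indicator measurableSet_Ioi]
        · refine Measurable.aemeasurable ?_
          have : (fun p : ℝ × ℝ => (Ioi (0:ℝ)).indicator (fun q => ENNReal.ofReal (q ^ (d-1)) * F (p.1, q • (η : EE d))) p.2)
            = (Prod.snd ⁻¹' Ioi (0:ℝ)).indicator (fun p : ℝ × ℝ => ENNReal.ofReal (p.2 ^ (d-1)) * F (p.1, p.2 • (η : EE d))) := by
            funext p; simp [indicator]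
          rw [this]
          refine Measurable.indicator (Measurable.mul (by fun_prop) (hF.comp (by fun_prop))) (measurable_snd measurableSet_Ioi)
    _ = ∫⁻ h : ℝ, ∫⁻ w, F (h, w) := by
        rw [lintegral_lintegral_swap]
        · refine lintegral_congr fun h => ?_
          rw [polar_w d hd _ (hFm h)]
        · refine Measurable.aemeasurable ?_
          refine Measurable.lintegral_prod_right' (f := fun x : (Metric.sphere (0 : EE d) 1 × ℝ) × ℝ => ENNReal.ofReal (x.2 ^ (d-1)) * F (x.1.2, x.2 • (x.1.1 : EE d))) ?_
          exact Measurable.mul (by fun_prop) (hF.comp (by fun_prop))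
    _ = _ := by rw [Measure.volume_eq_prod, lintegral_prod _ hF.aemeasurable]
  refine lintegral_mono fun η => ?_
  rw [← lintegral_comp_polarCoord_symm]
  have hsub : Ioc r T ×ˢ Ioc (0:ℝ) 1 ⊆ polarCoord.target := by
    rintro ⟨ρ, s⟩ ⟨h1, h2⟩
    have := pi_gt_three
    simp only [mem_Ioc] at h1 h2
    simp only [polarCoord_target, mem_prod, mem_Ioi, mem_Ioo]
    exact ⟨by linarith, by linarith, by linarith⟩
  refine le_trans ?_ (lintegral_mono_set hsub)
  rw [Measure.volume_eq_prod, ← Measure.prod_restrict, lintegral_prod_symm]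
  · refine lintegral_mono_ae ?_
    filter_upwards [ae_restrict_mem measurableSet_Ioc] with s hs
    refine lintegral_mono_ae ?_
    filter_upwards [ae_restrict_mem measurableSet_Ioc] with ρ hρ
    have h3 := pi_gt_three
    have hs0 : 0 < sin s := sin_pos_of_pos_of_lt_pi hs.1 (by linarith [hs.2])
    have hρ0 : 0 < ρ := hr.trans hρ.1
    have : ρ * sin s ∈ Ioi (0:ℝ) := mul_pos hρ0 hs0
    simp only [polarCoord_symm_apply, indicator_of_mem this, smul_eq_mul]
    rw [← mul_assoc, ← ENNReal.ofReal_mul hρ0.le]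
    refine le_of_eq ?_
    congr 2
    rw [mul_pow, ← mul_assoc]
    congr 1
    obtain ⟨e, rfl⟩ : ∃ e, d = e + 1 := ⟨d-1, by omega⟩
    simp [pow_succ, mul_comm]
  · refine Measurable.aemeasurable ?_
    have : (fun p : ℝ × ℝ => ENNReal.ofReal p.1 • (Ioi (0:ℝ)).indicator (fun q => ENNReal.ofReal (q ^ (d-1)) * F ((polarCoord.symm p).1, q • (η : EE d))) (polarCoord.symm p).2)
      = fun p => ENNReal.ofReal p.1 • ({p : ℝ × ℝ | 0 < p.1 * sin p.2}).indicator (fun p : ℝ × ℝ => ENNReal.ofReal ((p.1 * sin p.2) ^ (d-1)) * F (p.1 * cos p.2, (p.1 * sin p.2) • (η : EE d))) p := by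
      funext p; simp [indicator, polarCoord_symm_apply]
    rw [this]
    have hmeas : Measurable (fun p : ℝ × ℝ => ENNReal.ofReal ((p.1 * sin p.2) ^ (d-1)) * F (p.1 * cos p.2, (p.1 * sin p.2) • (η : EE d))) :=
      Measurable.mul (by fun_prop) (hF.comp (by fun_prop))
    refine Measurable.smul (f := fun p : ℝ × ℝ => ENNReal.ofReal p.1) (by fun_prop) (Measurable.indicator hmeas ?_)
    exact measurableSet_lt measurable_const (by fun_prop)

theorem rotIt_contDiff {n : ℕ} (l : List (Fin n × Fin n)) (φ : (Fin (n + 1) → ℝ) → ℝ)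
    (h : ContDiff ℝ (⊤ : ℕ∞) φ) : ContDiff ℝ (⊤ : ℕ∞) (rotIt l φ) := by
  induction l with
  | nil => exact h
  | cons p l ih =>
    unfold rotIt rotOp
    have h1 : ContDiff ℝ (⊤ : ℕ∞) (fderiv ℝ (rotIt l φ)) := ih.fderiv_right (by simp)
    refine h1.clm_apply ?_
    refine ContDiff.sub ?_ ?_
    · exact (ContinuousLinearMap.single ℝ (fun _ : Fin (n+1) => ℝ) p.2.succ).contDiff.comp (contDiff_apply ℝ ℝ p.1.succ)
    · exact (ContinuousLinearMap.single ℝ (fun _ : Fin (n+1) => ℝ) p.1.succ).contDiff.comp (contDiff_apply ℝ ℝ p.2.succ)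

theorem radn_cont {n : ℕ} : Continuous (radn : (Fin n → ℝ) → ℝ) := by
  unfold radn; fun_prop

theorem rotIt_zero_on {n : ℕ} (l : List (Fin n × Fin n)) (φ : (Fin (n + 1) → ℝ) → ℝ)
    (U : Set (Fin (n+1) → ℝ)) (hU : IsOpen U) (h : ∀ y ∈ U, φ y = 0) : ∀ y ∈ U, rotIt l φ y = 0 := by
  induction l with
  | nil => exact h
  | cons p l ih =>
    intro y hy
    have : rotIt l φ =ᶠ[nhds y] fun _ => 0 := by
      filter_upwards [hU.mem_nhds hy] with z hz using ih z hz
    unfold rotIt rotOp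
    rw [this.fderiv_eq]; simp

theorem radn_smul {n : ℕ} (ρ : ℝ) (hρ : 0 ≤ ρ) (θ : Fin n → ℝ) (hθ : ∑ i, θ i ^ 2 = 1) : radn (ρ • θ) = ρ := by
  unfold radn
  simp only [Pi.smul_apply, smul_eq_mul, mul_pow, ← Finset.mul_sum, hθ, mul_one]
  exact Real.sqrt_sq hρ

theorem cons_cont {n : ℕ} (t : ℝ) : Continuous (fun z : Fin n → ℝ => (Fin.cons t z : Fin (n+1) → ℝ)) := by
  refine continuous_pi fun i => ?_
  refine Fin.cases ?_ (fun i => ?_) i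
  · simpa using continuous_const
  · simpa using continuous_apply i

theorem rotIt_bdry {n : ℕ} (l : List (Fin n × Fin n)) (φ : (Fin (n + 1) → ℝ) → ℝ)
    (h : ContDiff ℝ (⊤ : ℕ∞) φ) (R : ℝ) (hR : 0 < R)
    (h0 : ∀ t : ℝ, 0 < t → ∀ x : Fin n → ℝ, t + R ≤ radn x → φ (Fin.cons t x) = 0)
    (t : ℝ) (ht : 0 < t) (θ : Fin n → ℝ) (hθ : ∑ i, θ i ^ 2 = 1) :
    rotIt l φ (Fin.cons t ((t + R) • θ)) = 0 := by
  let U : Set (Fin (n+1) → ℝ) := {y | 0 < y 0 ∧ y 0 + R < radn (fun i : Fin n => y i.succ)}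
  have hU : IsOpen U := by
    refine (isOpen_lt continuous_const (continuous_apply 0)).inter
      (isOpen_lt (f := fun y : Fin (n+1) → ℝ => y 0 + R) (by fun_prop) ?_)
    exact radn_cont.comp (by fun_prop)
  have hz := rotIt_zero_on l φ U hU (fun y hy => by
    have := h0 (y 0) hy.1 (fun i => y i.succ) hy.2.le
    rw [← this]; congr 1; ext i; refine Fin.cases ?_ (fun i => ?_) i <;> simp)
  have hc := (rotIt_contDiff l φ h).continuous
  have hcl : IsClosed {ρ : ℝ | rotIt l φ (Fin.cons t (ρ • θ)) = 0} :=
    isClosed_eq (hc.comp ((cons_cont t).comp (by fun_prop))) continuous_const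
  have hsub : Ioi (t+R) ⊆ {ρ : ℝ | rotIt l φ (Fin.cons t (ρ • θ)) = 0} := by
    intro ρ hρ
    rw [mem_Ioi] at hρ
    apply hz
    constructor
    · simpa using ht
    · have := radn_smul ρ (by linarith) θ hθ
      simp only [Fin.cons_zero, Fin.cons_succ]
      change t + R < radn (ρ • θ)
      rw [this]; exact hρ
  have := hcl.closure_subset_iff.2 hsub
  rw [closure_Ioi] at this
  exact this (le_refl (t+R))

def gr2 {n : ℕ} (u : (Fin (n + 1) → ℝ) → ℝ) (t : ℝ) (z : Fin n → ℝ) : ℝ :=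
  ∑ k : Fin n, (pdn k.succ u (Fin.cons t z)) ^ 2

theorem gr2_cont {n : ℕ} (u : (Fin (n + 1) → ℝ) → ℝ) (h : ContDiff ℝ (⊤ : ℕ∞) u) (t : ℝ) : Continuous (gr2 u t) := by
  unfold gr2 pdn
  have := h.continuous_fderiv (by simp)
  have := cons_cont (n := n) t
  fun_prop

theorem gr2_nonneg {n : ℕ} (u : (Fin (n + 1) → ℝ) → ℝ) (t : ℝ) (z : Fin n → ℝ) : 0 ≤ gr2 u t z :=
  Finset.sum_nonneg fun _ _ => sq_nonneg _

theorem hasDerivAt_cons {n : ℕ} (t : ℝ) (f : ℝ → Fin n → ℝ) (f' : Fin n → ℝ) (s : ℝ) (hf : HasDerivAt f f' s) :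
    HasDerivAt (fun s => (Fin.cons t (f s) : Fin (n+1) → ℝ)) (Fin.cons 0 f') s := by
  rw [hasDerivAt_pi] at hf ⊢
  intro i
  refine Fin.cases ?_ (fun i => ?_) i
  · simpa using hasDerivAt_const s t
  · simpa using hf i

theorem radial {d : ℕ} (u : (Fin (d + 1 + 1) → ℝ) → ℝ) (h : ContDiff ℝ (⊤ : ℕ∞) u) (t r T : ℝ) (hr : 0 < r)
    (hrT : r ≤ T) (θ : Fin (d+1) → ℝ) (hθ : ∑ i, θ i ^ 2 = 1) (h0 : u (Fin.cons t (T • θ)) = 0) :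
    u (Fin.cons t (r • θ)) ^ 2 ≤ (T - r) / r ^ d * ∫ ρ in r..T, ρ ^ d * gr2 u t (ρ • θ) := by
  have hcf := h.continuous_fderiv (by simp)
  have hcons : Continuous (fun ρ : ℝ => (Fin.cons t (ρ • θ) : Fin (d+1+1) → ℝ)) := (cons_cont t).comp (by fun_prop)
  have hgc : Continuous (fun ρ : ℝ => gr2 u t (ρ • θ)) := (gr2_cont u h t).comp (by fun_prop)
  let g : ℝ → ℝ := fun ρ => fderiv ℝ u (Fin.cons t (ρ • θ)) (Fin.cons 0 θ)
  have hg : Continuous g := by fun_prop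
  have hd : ∀ ρ, HasDerivAt (fun ρ : ℝ => u (Fin.cons t (ρ • θ))) (g ρ) ρ := by
    intro ρ
    have h1 : HasDerivAt (fun ρ : ℝ => ρ • θ) θ ρ := by
      simpa using (hasDerivAt_id ρ).smul_const θ
    exact ((h.differentiable (by simp)) _).hasFDerivAt.comp_hasDerivAt ρ (hasDerivAt_cons t _ _ ρ h1)
  have hI := intervalIntegral.integral_eq_sub_of_hasDerivAt (a := r) (b := T) (fun ρ _ => hd ρ) (hg.intervalIntegrable _ _)
  have hle : ∀ ρ, g ρ ^ 2 ≤ gr2 u t (ρ • θ) := by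
    intro ρ
    have hdec : (Fin.cons 0 θ : Fin (d+1+1) → ℝ) = ∑ k : Fin (d+1), θ k • Pi.single k.succ (1:ℝ) := by
      ext i
      refine Fin.cases ?_ (fun i => ?_) i
      · simp
      · simp [Pi.single_apply]
    have : g ρ = ∑ k : Fin (d+1), θ k * pdn k.succ u (Fin.cons t (ρ • θ)) := by
      simp only [g, hdec, map_sum, map_smul, smul_eq_mul, pdn]
    rw [this]
    refine (Finset.sum_mul_sq_le_sq_mul_sq _ _ _).trans ?_
    rw [hθ, one_mul]; rfl
  have e : u (Fin.cons t (r • θ)) ^ 2 = (∫ ρ in r..T, g ρ)^2 := by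
    rw [hI, h0]; ring
  rw [e]
  refine (cs_int r T hrT g hg).trans ?_
  rw [div_mul_eq_mul_div, mul_div_assoc]
  refine mul_le_mul_of_nonneg_left ?_ (by linarith)
  rw [le_div_iff₀ (by positivity), mul_comm, ← intervalIntegral.integral_const_mul]
  refine intervalIntegral.integral_mono_on hrT ?_ ?_ ?_
  · apply Continuous.intervalIntegrable; fun_prop
  · apply Continuous.intervalIntegrable; fun_prop
  intro ρ hρ
  exact mul_le_mul (pow_le_pow_left₀ hr.le hρ.1 d) (hle ρ) (sq_nonneg _) (pow_nonneg (hr.le.trans hρ.1) d)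

def Th {n : ℕ} (ω η : Fin n → ℝ) (s : ℝ) : Fin n → ℝ := cos s • ω + sin s • η

theorem Th_unit {n : ℕ} (ω η : Fin n → ℝ) (hω : ∑ i, ω i ^ 2 = 1) (hη : ∑ i, η i ^ 2 = 1)
    (hωη : ∑ i, ω i * η i = 0) (s : ℝ) : ∑ i, Th ω η s i ^ 2 = 1 := by
  have : ∀ i, Th ω η s i ^ 2 = cos s ^ 2 * ω i ^ 2 + sin s ^ 2 * η i ^2 + 2 * cos s * sin s * (ω i * η i) := by
    intro i; simp [Th]; ring
  simp only [this, Finset.sum_add_distrib, ← Finset.mul_sum, hω, hη, hωη]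
  simp

theorem rot_deriv {n : ℕ} (u : (Fin (n + 1) → ℝ) → ℝ) (h : ContDiff ℝ (⊤ : ℕ∞) u)
    (ω η : Fin n → ℝ) (hω : ∑ i, ω i ^ 2 = 1) (hη : ∑ i, η i ^ 2 = 1)
    (hωη : ∑ i, ω i * η i = 0) (t r s : ℝ) :
    HasDerivAt (fun s => u (Fin.cons t (r • Th ω η s)))
      (∑ p : Fin n × Fin n, (ω p.1 * η p.2) * rotOp p u (Fin.cons t (r • Th ω η s))) s := by
  have h1 : HasDerivAt (fun s => r • Th ω η s) (r • (-sin s • ω + cos s • η)) s :=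
    (((hasDerivAt_cos s).smul_const ω).add ((hasDerivAt_sin s).smul_const η)).const_smul r
  have h2 := ((h.differentiable (by simp)) _).hasFDerivAt.comp_hasDerivAt s (hasDerivAt_cons t _ _ s h1)
  refine h2.congr_deriv ?_
  simp only [rotOp, ← smul_eq_mul, ← map_smul, ← map_sum]
  congr 1
  have hA : ∑ i, ω i * Th ω η s i = cos s := by
    have : ∀ i, ω i * Th ω η s i = cos s * ω i ^ 2 + sin s * (ω i * η i) := by
      intro i; simp [Th]; ring
    simp only [this, Finset.sum_add_distrib, ← Finset.mul_sum, hω, hωη]; simp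
  have hB : ∑ i, η i * Th ω η s i = sin s := by
    have : ∀ i, η i * Th ω η s i = sin s * η i ^ 2 + cos s * (ω i * η i) := by
      intro i; simp [Th]; ring
    simp only [this, Finset.sum_add_distrib, ← Finset.mul_sum, hη, hωη]; simp
  ext m
  refine Fin.cases ?_ (fun m => ?_) m
  · simp
  · rw [Fintype.sum_prod_type]
    simp only [Fin.cons_succ, Pi.smul_apply, Pi.add_apply, smul_eq_mul, Finset.sum_apply, Pi.sub_apply,
      Pi.single_apply, Fin.succ_inj]
    have e : ∀ i j, ω i * η j * ((if m = j then r * Th ω η s i else 0) - (if m = i then r * Th ω η s j else 0))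
      = (if m = j then r * (η m * (ω i * Th ω η s i)) else 0) - (if m = i then r * (ω m * (η j * Th ω η s j)) else 0) := by
      intro i j
      split_ifs with h1 h2 h2 <;> (try subst h1) <;> (try subst h2) <;> ring
    simp only [e, Finset.sum_sub_distrib, Finset.sum_ite_eq, Finset.mem_univ, if_true]
    rw [Finset.sum_comm (f := fun i j => if m = i then r * (ω m * (η j * Th ω η s j)) else 0)]
    simp only [Finset.sum_ite_eq, Finset.mem_univ, if_true, ← Finset.mul_sum, hA, hB]
    ring

theorem mem_rotLists {n : ℕ} (m : ℕ) (l : List (Fin n × Fin n)) (h : l.length ≤ m) : l ∈ rotLists n m := by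
  induction m generalizing l with
  | zero =>
    have : l = [] := List.length_eq_zero_iff.1 (by omega)
    simp [rotLists, this]
  | succ m ih =>
    cases l with
    | nil => simp [rotLists]
    | cons p l =>
      simp only [rotLists, List.mem_cons, List.mem_flatMap, List.mem_map]
      right
      exact ⟨l, ih l (by simpa using h), p, by simp, rfl⟩

/-- the chain of derivatives along a great circle -/
def GG {n : ℕ} (φ : (Fin (n + 1) → ℝ) → ℝ) (ω η : Fin n → ℝ) (t r : ℝ) (j : ℕ) (s : ℝ) : ℝ :=
  ∑ f : Fin j → Fin n × Fin n, (∏ i, (ω (f i).1 * η (f i).2)) * rotIt (List.ofFn f) φ (Fin.cons t (r • Th ω η s))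

theorem GG_deriv {n : ℕ} (φ : (Fin (n + 1) → ℝ) → ℝ) (h : ContDiff ℝ (⊤ : ℕ∞) φ)
    (ω η : Fin n → ℝ) (hω : ∑ i, ω i ^ 2 = 1) (hη : ∑ i, η i ^ 2 = 1)
    (hωη : ∑ i, ω i * η i = 0) (t r : ℝ) (j : ℕ) (s : ℝ) :
    HasDerivAt (GG φ ω η t r j) (GG φ ω η t r (j+1) s) s := by
  have h1 : HasDerivAt (GG φ ω η t r j) (∑ f : Fin j → Fin n × Fin n, (∏ i, (ω (f i).1 * η (f i).2)) *
      ∑ p : Fin n × Fin n, (ω p.1 * η p.2) * rotOp p (rotIt (List.ofFn f) φ) (Fin.cons t (r • Th ω η s))) s := by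
    unfold GG
    refine HasDerivAt.fun_sum fun f _ => ?_
    exact (rot_deriv _ (rotIt_contDiff _ φ h) ω η hω hη hωη t r s).const_mul _
  refine h1.congr_deriv ?_
  unfold GG
  rw [← (Fin.consEquiv (fun _ : Fin (j+1) => Fin n × Fin n)).sum_comp, Fintype.sum_prod_type, Finset.sum_comm]
  refine Finset.sum_congr rfl fun f _ => ?_
  rw [Finset.mul_sum]
  refine Finset.sum_congr rfl fun p _ => ?_
  simp [Fin.consEquiv, Fin.prod_univ_succ, List.ofFn_succ, rotIt]
  ring

theorem abs_le_one_of_unit {n : ℕ} (ω : Fin n → ℝ) (hω : ∑ i, ω i ^ 2 = 1) (i : Fin n) : |ω i| ≤ 1 := by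
  rw [← sq_le_one_iff_abs_le_one, ← hω]
  exact Finset.single_le_sum (f := fun i => ω i ^ 2) (fun i _ => sq_nonneg _) (Finset.mem_univ i)

theorem GG_sq {n : ℕ} (φ : (Fin (n + 1) → ℝ) → ℝ)
    (ω η : Fin n → ℝ) (hω : ∑ i, ω i ^ 2 = 1) (hη : ∑ i, η i ^ 2 = 1) (t r : ℝ) (j : ℕ) (s : ℝ) :
    GG φ ω η t r j s ^ 2 ≤ (Fintype.card (Fin j → Fin n × Fin n) : ℝ) *
      ∑ f : Fin j → Fin n × Fin n, rotIt (List.ofFn f) φ (Fin.cons t (r • Th ω η s)) ^ 2 := by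
  unfold GG
  refine sq_sum_le_card_mul_sum_sq.trans ?_
  rw [Finset.card_univ]
  refine mul_le_mul_of_nonneg_left (Finset.sum_le_sum fun f _ => ?_) (by positivity)
  rw [mul_pow]
  refine mul_le_of_le_one_left (sq_nonneg _) ?_
  rw [sq_le_one_iff_abs_le_one, Finset.abs_prod]
  refine Finset.prod_le_one (fun i _ => abs_nonneg _) (fun i _ => ?_)
  rw [abs_mul]
  exact mul_le_one₀ (abs_le_one_of_unit ω hω _) (abs_nonneg _) (abs_le_one_of_unit η hη _)

def Etot {n : ℕ} (m : ℕ) (φ : (Fin (n + 1) → ℝ) → ℝ) (t : ℝ) (z : Fin n → ℝ) : ℝ :=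
  ∑ j ∈ Finset.range m, ∑ f : Fin j → Fin n × Fin n, gr2 (rotIt (List.ofFn f) φ) t z

theorem Etot_nonneg {n : ℕ} (m : ℕ) (φ : (Fin (n + 1) → ℝ) → ℝ) (t : ℝ) (z : Fin n → ℝ) : 0 ≤ Etot m φ t z :=
  Finset.sum_nonneg fun _ _ => Finset.sum_nonneg fun _ _ => gr2_nonneg _ _ _

theorem Etot_cont {n : ℕ} (m : ℕ) (φ : (Fin (n + 1) → ℝ) → ℝ) (h : ContDiff ℝ (⊤ : ℕ∞) φ) (t : ℝ) :
    Continuous (Etot m φ t) :=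
  continuous_finsetSum _ fun _ _ => continuous_finsetSum _ fun _ _ => gr2_cont _ (rotIt_contDiff _ φ h) t

theorem sin_weight (d : ℕ) (s : ℝ) (h0 : 0 ≤ s) (h1 : s ≤ 1) : s ^ (2 * (d/2)) ≤ 2 ^ (d-1) * sin s ^ (d-1) := by
  have hpi := pi_gt_three
  have hpi4 := pi_le_four
  have h2 := Real.mul_le_sin h0 (by linarith)
  have h3 : s ≤ 2 * sin s := by
    have : (1/2:ℝ) ≤ 2 / π := by rw [div_le_div_iff₀ (by norm_num) pi_pos]; linarith
    nlinarith
  calc s ^ (2 * (d/2)) ≤ s ^ (d-1) := pow_le_pow_of_le_one h0 h1 (by omega)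
    _ ≤ (2 * sin s) ^ (d-1) := pow_le_pow_left₀ h0 h3 _
    _ = _ := mul_pow _ _ _

theorem Th_cont {n : ℕ} (ω η : Fin n → ℝ) : Continuous (Th ω η) := by unfold Th; fun_prop

theorem per_eta (d : ℕ) : ∃ A > (0:ℝ), ∀ (R : ℝ), 0 < R → ∀ φ : (Fin (d + 1 + 1) → ℝ) → ℝ, ContDiff ℝ (⊤ : ℕ∞) φ →
    (∀ t : ℝ, 0 < t → ∀ x : Fin (d+1) → ℝ, t + R ≤ radn x → φ (Fin.cons t x) = 0) →
    ∀ t : ℝ, 0 < t → ∀ r : ℝ, 0 < r → r < t + R → ∀ ω η : Fin (d+1) → ℝ, ∑ i, ω i ^ 2 = 1 → ∑ i, η i ^ 2 = 1 →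
    ∑ i, ω i * η i = 0 →
    φ (Fin.cons t (r • ω)) ^ 2 ≤ A * ((t + R - r) / r ^ d) *
      ∫ s in (0:ℝ)..1, ∫ ρ in r..(t+R), ρ ^ d * sin s ^ (d-1) * Etot (d/2+2) φ t (ρ • Th ω η s) := by
  obtain ⟨C, hC, hrep⟩ := repsq (d/2)
  let K : ℝ := ∑ j ∈ Finset.range (d/2+2), (Fintype.card (Fin j → Fin (d+1) × Fin (d+1)) : ℝ)
  have hK : 0 < K := Finset.sum_pos (fun j _ => by exact_mod_cast Fintype.card_pos) ⟨0, by simp⟩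
  refine ⟨C * (2 ^ (d-1) * K), by positivity, fun R hR φ hφ h0 t ht r hr hrT ω η hω hη hωη => ?_⟩
  have hG := fun j s => GG_deriv φ hφ ω η hω hη hωη t r j s
  have h1 := hrep (GG φ ω η t r) hG
  have hGc : ∀ j, Continuous (GG φ ω η t r j) := fun j => continuous_iff_continuousAt.2 fun s => (hG j s).continuousAt
  have h00 : GG φ ω η t r 0 0 = φ (Fin.cons t (r • ω)) := by
    simp [GG, Th, rotIt]
  rw [h00] at h1
  refine h1.trans ?_
  have hjc : Continuous (Function.uncurry fun (s ρ : ℝ) => ρ ^ d * sin s ^ (d-1) * Etot (d/2+2) φ t (ρ • Th ω η s)) := by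
    have h1 : Continuous (fun p : ℝ × ℝ => Etot (d/2+2) φ t (p.2 • Th ω η p.1)) :=
      (Etot_cont _ φ hφ t).comp (continuous_snd.smul ((Th_cont ω η).comp continuous_fst))
    simp only [Function.uncurry_def]
    fun_prop
  have hic : Continuous fun s => ∫ ρ in r..(t+R), ρ ^ d * sin s ^ (d-1) * Etot (d/2+2) φ t (ρ • Th ω η s) :=
    intervalIntegral.continuous_parametric_intervalIntegral_of_continuous' hjc _ _
  rw [mul_assoc, mul_assoc C]
  refine mul_le_mul_of_nonneg_left ?_ hC.le
  rw [← intervalIntegral.integral_finset_sum, ← mul_assoc, ← intervalIntegral.integral_const_mul]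
  · refine intervalIntegral.integral_mono_on zero_le_one ?_ ?_ ?_
    · refine Continuous.intervalIntegrable (continuous_finsetSum _ fun j _ => ?_) _ _
      have := hGc j
      fun_prop
    · exact (hic.const_mul _).intervalIntegrable _ _
    intro s hs
    have hpi := pi_gt_three
    have hsin : 0 ≤ sin s := sin_nonneg_of_nonneg_of_le_pi hs.1 (by linarith [hs.2])
    have hTu := Th_unit ω η hω hη hωη s
    have hgc : ∀ j, ∀ f : Fin j → Fin (d+1) × Fin (d+1), Continuous fun ρ : ℝ => gr2 (rotIt (List.ofFn f) φ) t (ρ • Th ω η s) :=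
      fun j f => (gr2_cont _ (rotIt_contDiff _ φ hφ) t).comp (by fun_prop)
    have hT0 : 0 ≤ (t + R - r) / r ^ d := div_nonneg (by linarith) (by positivity)
    have hIn : ∀ j, ∀ f : Fin j → Fin (d+1) × Fin (d+1), 0 ≤ ∫ ρ in r..(t+R), ρ ^ d * gr2 (rotIt (List.ofFn f) φ) t (ρ • Th ω η s) :=
      fun j f => intervalIntegral.integral_nonneg hrT.le fun ρ hρ => mul_nonneg (pow_nonneg (hr.le.trans hρ.1) d) (gr2_nonneg _ _ _)
    have hE : ∫ ρ in r..(t+R), ρ ^ d * sin s ^ (d-1) * Etot (d/2+2) φ t (ρ • Th ω η s)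
        = sin s ^ (d-1) * ∑ j ∈ Finset.range (d/2+2), ∑ f : Fin j → Fin (d+1) × Fin (d+1),
            ∫ ρ in r..(t+R), ρ ^ d * gr2 (rotIt (List.ofFn f) φ) t (ρ • Th ω η s) := by
      have : ∀ j ∈ Finset.range (d/2+2), ∑ f : Fin j → Fin (d+1) × Fin (d+1),
            ∫ ρ in r..(t+R), ρ ^ d * gr2 (rotIt (List.ofFn f) φ) t (ρ • Th ω η s) =
            ∫ ρ in r..(t+R), ∑ f : Fin j → Fin (d+1) × Fin (d+1), ρ ^ d * gr2 (rotIt (List.ofFn f) φ) t (ρ • Th ω η s) := by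
        intro j _
        rw [intervalIntegral.integral_finset_sum]
        intro f _
        have := hgc j f
        apply Continuous.intervalIntegrable; fun_prop
      rw [Finset.sum_congr rfl this, ← intervalIntegral.integral_finset_sum, ← intervalIntegral.integral_const_mul]
      · refine intervalIntegral.integral_congr fun ρ _ => ?_
        simp only [Etot, ← Finset.mul_sum]
        ring
      · intro j _
        refine Continuous.intervalIntegrable (continuous_finsetSum _ fun f _ => ?_) _ _
        have := hgc j f
        fun_prop
    rw [hE]
    have hj : ∀ j ∈ Finset.range (d/2+2), s ^ (2 * (d/2)) * GG φ ω η t r j s ^ 2 ≤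
        (2 ^ (d-1) * sin s ^ (d-1)) * (K * ∑ f : Fin j → Fin (d+1) × Fin (d+1), (t+R-r)/r^d * 
            ∫ ρ in r..(t+R), ρ ^ d * gr2 (rotIt (List.ofFn f) φ) t (ρ • Th ω η s)) := by
      intro j hj
      refine mul_le_mul (sin_weight d s hs.1 hs.2) ?_ (sq_nonneg _) (by positivity)
      refine (GG_sq φ ω η hω hη t r j s).trans ?_
      refine mul_le_mul ?_ ?_ (Finset.sum_nonneg fun _ _ => sq_nonneg _) hK.le
      · exact Finset.single_le_sum (f := fun j => (Fintype.card (Fin j → Fin (d+1) × Fin (d+1)) : ℝ)) (fun _ _ => by positivity) hj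
      · refine Finset.sum_le_sum fun f _ => ?_
        exact radial _ (rotIt_contDiff _ φ hφ) t r (t+R) hr hrT.le _ hTu
          (rotIt_bdry _ φ hφ R hR h0 t ht _ hTu)
    refine (Finset.sum_le_sum hj).trans (le_of_eq ?_)
    simp only [← Finset.mul_sum]
    ring
  · intro j _
    have := hGc j
    apply Continuous.intervalIntegrable; fun_prop

theorem radn_unit {n : ℕ} (ω : Fin n → ℝ) (h : radn ω = 1) : ∑ i, ω i ^ 2 = 1 := by
  unfold radn at h
  rwa [Real.sqrt_eq_one] at h

theorem ball_integrable {n : ℕ} (T : ℝ) (g : (Fin n → ℝ) → ℝ) (hg : Continuous g) :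
    IntegrableOn g {z : Fin n → ℝ | radn z < T} volume := by
  have hsub : {z : Fin n → ℝ | radn z < T} ⊆ Icc (fun _ => -T) (fun _ => T) := by
    intro z hz
    have : ∀ i, |z i| ≤ T := by
      intro i
      refine le_trans ?_ (le_of_lt hz)
      unfold radn
      rw [← Real.sqrt_sq_eq_abs]
      exact Real.sqrt_le_sqrt (Finset.single_le_sum (f := fun i => z i ^ 2) (fun i _ => sq_nonneg _) (Finset.mem_univ i))
    exact ⟨fun i => (abs_le.1 (this i)).1, fun i => (abs_le.1 (this i)).2⟩
  exact (hg.continuousOn.integrableOn_compact isCompact_Icc).mono_set hsub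

theorem ball_meas {n : ℕ} (T : ℝ) : MeasurableSet {z : Fin n → ℝ | radn z < T} :=
  (isOpen_lt radn_cont continuous_const).measurableSet

theorem sphere_avg (d : ℕ) (hd : 1 ≤ d) : ∃ A > (0:ℝ), ∀ (R : ℝ), 0 < R → ∀ φ : (Fin (d + 1 + 1) → ℝ) → ℝ, ContDiff ℝ (⊤ : ℕ∞) φ →
    (∀ t : ℝ, 0 < t → ∀ x : Fin (d+1) → ℝ, t + R ≤ radn x → φ (Fin.cons t x) = 0) →
    ∀ t : ℝ, 0 < t → ∀ r : ℝ, 0 < r → r < t + R → ∀ ω : Fin (d+1) → ℝ, ∑ i, ω i ^ 2 = 1 →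
    φ (Fin.cons t (r • ω)) ^ 2 ≤ A * ((t + R - r) / r ^ d) *
      ∫ z in {z : Fin (d+1) → ℝ | radn z < t + R}, Etot (d/2+2) φ t z := by
  obtain ⟨A, hA, hper⟩ := per_eta d
  have hnt : Nontrivial (EE d) := by
    have : Nonempty (Fin d) := ⟨⟨0, hd⟩⟩
    infer_instance
  let σ : Measure (Metric.sphere (0 : EE d) 1) := (volume : Measure (EE d)).toSphere
  have hσ0 : σ univ ≠ 0 := by
    rw [Ne, Measure.measure_univ_eq_zero]; exact Measure.toSphere_ne_zero _
  have hσt : σ univ ≠ ⊤ := measure_ne_top _ _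
  have hσ : 0 < (σ univ).toReal := ENNReal.toReal_pos hσ0 hσt
  refine ⟨A / (σ univ).toReal, by positivity, fun R hR φ hφ h0 t ht r hr hrT ω hω => ?_⟩
  obtain ⟨L, hLm, hLo, hLn⟩ := frame d ω hω
  set T := t + R with hT
  set B := {z : Fin (d+1) → ℝ | radn z < T} with hB
  set c := A * ((T - r) / r ^ d) with hc
  have hc0 : 0 ≤ c := mul_nonneg hA.le (div_nonneg (by linarith) (by positivity))
  have hEc := Etot_cont (d/2+2) φ hφ t
  let F0 : (Fin (d+1) → ℝ) → ℝ≥0∞ := B.indicator fun z => ENNReal.ofReal (Etot (d/2+2) φ t z)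
  have hF0 : Measurable F0 := Measurable.indicator (by fun_prop) (ball_meas T)
  let F : ℝ × EE d → ℝ≥0∞ := fun p => F0 (p.1 • ω + L p.2)
  have hF : Measurable F := hF0.comp hLm.measurable
  have hInt : ∫⁻ p, F p = ENNReal.ofReal (∫ z in B, Etot (d/2+2) φ t z) := by
    rw [hLm.lintegral_comp hF0, lintegral_indicator (ball_meas T),
      ofReal_integral_eq_lintegral_ofReal (ball_integrable T _ hEc) (Filter.Eventually.of_forall fun z => Etot_nonneg _ _ _ _)]
  have hpe : ∀ η : Metric.sphere (0 : EE d) 1, ENNReal.ofReal (φ (Fin.cons t (r • ω)) ^ 2) ≤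
      ENNReal.ofReal c * ∫⁻ s in Ioc (0:ℝ) 1, ∫⁻ ρ in Ioc r T,
      ENNReal.ofReal (ρ ^ d * sin s ^ (d-1)) * F (ρ * cos s, (ρ * sin s) • (η : EE d)) := by
    intro η
    have hη : ∑ i, (L η i)^2 = 1 := by rw [hLn]; simp
    have h1 := hper R hR φ hφ h0 t ht r hr hrT ω (L η) hω hη (hLo η)
    have hjc : Continuous (Function.uncurry fun (s ρ : ℝ) => ρ ^ d * sin s ^ (d-1) * Etot (d/2+2) φ t (ρ • Th ω (L η) s)) := by
      have h1 : Continuous (fun p : ℝ × ℝ => Etot (d/2+2) φ t (p.2 • Th ω (L η) p.1)) :=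
        (Etot_cont _ φ hφ t).comp (continuous_snd.smul ((Th_cont ω _).comp continuous_fst))
      simp only [Function.uncurry_def]
      fun_prop
    have hic : Continuous fun s => ∫ ρ in r..T, ρ ^ d * sin s ^ (d-1) * Etot (d/2+2) φ t (ρ • Th ω (L η) s) :=
      intervalIntegral.continuous_parametric_intervalIntegral_of_continuous' hjc _ _
    have hpi := pi_gt_three
    have hnn : ∀ s ∈ Ioc (0:ℝ) 1, ∀ ρ ∈ Ioc r T, 0 ≤ ρ ^ d * sin s ^ (d-1) := by
      intro s hs ρ hρ
      have hsin : 0 ≤ sin s := sin_nonneg_of_nonneg_of_le_pi hs.1.le (by linarith [hs.2])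
      have : 0 ≤ ρ := hr.le.trans hρ.1.le
      positivity
    refine (ENNReal.ofReal_le_ofReal h1).trans ?_
    rw [ENNReal.ofReal_mul hc0]
    refine mul_le_mul_right ?_ _
    rw [intervalIntegral.integral_of_le zero_le_one, ofReal_integral_eq_lintegral_ofReal]
    · refine lintegral_mono_ae ?_
      filter_upwards [ae_restrict_mem measurableSet_Ioc] with s hs
      rw [intervalIntegral.integral_of_le hrT.le, ofReal_integral_eq_lintegral_ofReal]
      · rw [← restrict_Ioo_eq_restrict_Ioc]
        refine lintegral_mono_ae ?_
        filter_upwards [ae_restrict_mem measurableSet_Ioo] with ρ hρ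
        rw [ENNReal.ofReal_mul (hnn s hs ρ ⟨hρ.1, hρ.2.le⟩)]
        refine mul_le_mul_right ?_ _
        have e : (ρ * cos s) • ω + L ((ρ * sin s) • (η : EE d)) = ρ • Th ω (L η) s := by
          simp [Th, smul_smul]
        have hmem : ρ • Th ω (L η) s ∈ B := by
          rw [hB, mem_setOf_eq, radn_smul ρ (hr.trans hρ.1).le _ (Th_unit ω _ hω hη (hLo η) s)]
          exact hρ.2
        simp only [F, F0, e]
        rw [indicator_of_mem hmem]
      · have hc2 : Continuous fun ρ : ℝ => ρ ^ d * sin s ^ (d-1) * Etot (d/2+2) φ t (ρ • Th ω (L η) s) :=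
          hjc.comp (Continuous.prodMk_right s)
        exact (hc2.intervalIntegrable r T).1
      · filter_upwards [ae_restrict_mem measurableSet_Ioc] with ρ hρ
        exact mul_nonneg (hnn s hs ρ hρ) (Etot_nonneg _ _ _ _)
    · exact (hic.intervalIntegrable 0 1).1
    · filter_upwards [ae_restrict_mem measurableSet_Ioc] with s hs
      rw [intervalIntegral.integral_of_le hrT.le]
      refine setIntegral_nonneg measurableSet_Ioc fun ρ hρ => mul_nonneg (hnn s hs ρ hρ) (Etot_nonneg _ _ _ _)
  have hfin : ENNReal.ofReal (φ (Fin.cons t (r • ω)) ^ 2) * σ univ ≤ ENNReal.ofReal c * ENNReal.ofReal (∫ z in B, Etot (d/2+2) φ t z) := by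
    rw [← lintegral_const, ← hInt]
    refine (lintegral_mono hpe).trans ?_
    rw [lintegral_const_mul' _ _ ENNReal.ofReal_ne_top]
    exact mul_le_mul_right (polar_le d hd F hF r T hr) _
  rw [← ENNReal.ofReal_toReal hσt, ← ENNReal.ofReal_mul (sq_nonneg _), ← ENNReal.ofReal_mul hc0, 
    ENNReal.ofReal_le_ofReal_iff (mul_nonneg hc0 (integral_nonneg fun z => Etot_nonneg _ _ _ _))] at hfin
  rw [div_mul_eq_mul_div, div_mul_eq_mul_div, le_div_iff₀ hσ]
  exact hfin

theorem final_alg (d : ℕ) (A M : ℝ) (hA : 0 < A) (hM : 0 < M) (t R r : ℝ) (hr : 0 < r) (hrT : r < t + R)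
    (v S : ℝ) (hSn : 0 ≤ S) (h3 : v ^ 2 ≤ A * ((t + R - r) / r ^ d) * (M * S^2)) :
    r ^ ((((d+1 : ℕ) : ℝ) - 1) / 2) * (t - r + R) ^ (-(1 : ℝ) / 2) * |v| ≤ Real.sqrt (A * M) * S := by
  have hTr : 0 < t + R - r := by linarith
  have hX : 0 ≤ r ^ ((((d+1 : ℕ) : ℝ) - 1) / 2) * (t - r + R) ^ (-(1 : ℝ) / 2) * |v| := by
    have : 0 < t - r + R := by linarith
    positivity
  refine (sq_le_sq₀ hX (by positivity)).1 ?_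
  have e1 : (r ^ ((((d+1 : ℕ) : ℝ) - 1) / 2)) ^ 2 = r ^ d := by
    rw [← Real.rpow_natCast, ← Real.rpow_mul hr.le, ← Real.rpow_natCast]
    congr 1
    push_cast; ring
  have e2 : ((t - r + R) ^ (-(1 : ℝ) / 2)) ^ 2 = (t + R - r)⁻¹ := by
    have e : t - r + R = t + R - r := by ring
    rw [e, ← Real.rpow_natCast, ← Real.rpow_mul hTr.le, ← Real.rpow_neg_one]
    congr 1
    push_cast; ring
  rw [mul_pow, mul_pow, mul_pow, e1, e2, sq_abs, Real.sq_sqrt (by positivity)]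
  refine (mul_le_mul_of_nonneg_left h3 (by positivity)).trans (le_of_eq ?_)
  have := hTr.ne'
  field_simp

/-- **Estimate (A.2).** For `n ≥ 2` there is `C = C(n) > 0` such that for any `R > 0` and
smooth `φ` with `supp φ(t,·) ⊂ {|x| < t + R}`, for `t > 0`, `0 < r < t + R` and any unit
vector `ω`:
`r^{(n-1)/2}(t-r+R)^{-1/2}|φ(t,rω)|
  ≤ C Σ_{|a| ≤ [(n-1)/2]+1} (∫₀^{t+R}∫_{S^{n-1}} |(∇_x Ω^a φ)(t,ρω)|² ρ^{n-1} dρ dS)^{1/2}`,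
the right-hand side being written, via polar coordinates, as the `L²` norm of
`∇_x Ω^a φ(t,·)` over the ball `{|x| < t + R}`. -/
theorem stmt15_trace_decay_estimate (n : ℕ) (hn : 2 ≤ n) :
    ∃ C > (0 : ℝ),
      ∀ R : ℝ, 0 < R →
      ∀ φ : (Fin (n + 1) → ℝ) → ℝ, ContDiff ℝ (⊤ : ℕ∞) φ →
        (∀ t : ℝ, 0 < t → ∀ x : Fin n → ℝ, t + R ≤ radn x → φ (Fin.cons t x) = 0) →
        ∀ t : ℝ, 0 < t → ∀ r : ℝ, 0 < r → r < t + R →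
        ∀ ω : Fin n → ℝ, radn ω = 1 →
          r ^ (((n : ℝ) - 1) / 2) * (t - r + R) ^ (-(1 : ℝ) / 2) * |φ (Fin.cons t (r • ω))|
            ≤ C * ((rotLists n ((n - 1) / 2 + 1)).map fun l =>
                Real.sqrt (∫ z in {z : Fin n → ℝ | radn z < t + R},
                  ∑ k : Fin n, (pdn k.succ (rotIt l φ) (Fin.cons t z)) ^ 2)).sum := by
  obtain ⟨d, rfl⟩ : ∃ d, n = d + 1 := ⟨n - 1, by omega⟩
  obtain ⟨A, hA, hmain⟩ := sphere_avg d (by omega)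
  let M : ℝ := ∑ j ∈ Finset.range (d/2+2), ∑ _f : Fin j → Fin (d+1) × Fin (d+1), 1
  have hM : 0 < M := by
    refine Finset.sum_pos (fun j _ => ?_) ⟨0, by simp⟩
    rw [Finset.sum_const, Finset.card_univ, nsmul_eq_mul, mul_one]
    exact_mod_cast Fintype.card_pos
  refine ⟨Real.sqrt (A * M), Real.sqrt_pos.2 (mul_pos hA hM), fun R hR φ hφ h0 t ht r hr hrT ω hω => ?_⟩
  have h1 := hmain R hR φ hφ h0 t ht r hr hrT ω (radn_unit ω hω)
  have hk : (d + 1 - 1) / 2 + 1 = d/2 + 1 := by simp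
  rw [hk]
  set N : List (Fin (d+1) × Fin (d+1)) → ℝ := fun l => Real.sqrt (∫ z in {z : Fin (d+1) → ℝ | radn z < t + R},
                  ∑ k : Fin (d+1), (pdn k.succ (rotIt l φ) (Fin.cons t z)) ^ 2) with hN
  set S := ((rotLists (d+1) (d/2+1)).map N).sum with hS
  have hSn : 0 ≤ S := List.sum_nonneg (by
    intro x hx
    obtain ⟨l, _, rfl⟩ := List.mem_map.1 hx
    exact Real.sqrt_nonneg _)
  have hle : ∀ l : List (Fin (d+1) × Fin (d+1)), l.length ≤ d/2+1 → N l ≤ S := by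
    intro l hl
    refine List.single_le_sum (fun x hx => ?_) _ (List.mem_map.2 ⟨l, mem_rotLists _ l hl, rfl⟩)
    obtain ⟨l, _, rfl⟩ := List.mem_map.1 hx
    exact Real.sqrt_nonneg _
  have hE : ∫ z in {z : Fin (d+1) → ℝ | radn z < t + R}, Etot (d/2+2) φ t z ≤ M * S^2 := by
    unfold Etot
    have hi : ∀ j, ∀ f : Fin j → Fin (d+1) × Fin (d+1), IntegrableOn (gr2 (rotIt (List.ofFn f) φ) t) {z : Fin (d+1) → ℝ | radn z < t + R} :=
      fun j f => ball_integrable _ _ (gr2_cont _ (rotIt_contDiff _ φ hφ) t)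
    rw [integral_finset_sum _ (fun j _ => integrable_finset_sum _ fun f _ => hi j f), Finset.sum_mul]
    refine Finset.sum_le_sum fun j hj => ?_
    rw [integral_finset_sum _ (fun f _ => hi j f), Finset.sum_mul]
    refine Finset.sum_le_sum fun f _ => ?_
    have hl := hle (List.ofFn f) (by simp; have := Finset.mem_range.1 hj; omega)
    rw [one_mul]
    have h2 : ∫ z in {z : Fin (d+1) → ℝ | radn z < t + R}, gr2 (rotIt (List.ofFn f) φ) t z = N (List.ofFn f) ^ 2 := by
      rw [hN]
      exact (Real.sq_sqrt (integral_nonneg fun z => gr2_nonneg _ t z)).symm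
    rw [h2]
    exact pow_le_pow_left₀ (Real.sqrt_nonneg _) hl 2
  exact final_alg d A M hA hM t R r hr hrT _ S hSn (h1.trans (mul_le_mul_of_nonneg_left hE
    (mul_nonneg hA.le (div_nonneg (by linarith) (pow_nonneg hr.le d)))))
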